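/- Let R be a Krull domain, i.e., an integral domain such that for every nonzero ideal I of R there exists a GV-ideal J with J ⊆ I·I⁻¹, where I⁻¹ = {x ∈ K : xI ⊆ R} and K is the quotient field. Then: (a) for every R-module M, the torsion submodule T(M) is a w-pure submodule of M; and (b) for every finitely generated R-module M, the canonical short exact sequence 0 → T(M) → M →π→ M/T(M) → 0 w-splits: there exists a GV-ideal J such that for every d ∈ J there is an R-homomorphism h : M/T(M) → M with π ∘ h = d·id. -/

import Mathlib

open TensorProduct

/-- A finitely generated ideal `J` is a GV-ideal if the natural map
`R → Hom_R(J, R)`, sending `r` to multiplication by `r`, is bijective. -/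
def IsGVIdeal {R : Type*} [CommRing R] (J : Ideal R) : Prop :=
  J.FG ∧ Function.Bijective fun r : R => (r • J.subtype : J →ₗ[R] R)

/-- An element `m` of an `R`-module is a GV-torsion element if it is
annihilated by some GV-ideal. -/
def IsGVTorsionElem (R : Type*) [CommRing R] {M : Type*} [AddCommGroup M] [Module R M]
    (m : M) : Prop :=
  ∃ J : Ideal R, IsGVIdeal J ∧ ∀ j ∈ J, j • m = 0

/-- An integral domain `R` is a Krull domain (as in the statement) if for every
nonzero ideal `I` of `R` there is a GV-ideal `J` with `J ⊆ I·I⁻¹`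
(inside the quotient field `K`). -/
def IsKrullDomainW (R : Type*) [CommRing R] [IsDomain R] (K : Type*) [Field K]
    [Algebra R K] [IsFractionRing R K] : Prop :=
  ∀ I : Ideal R, I ≠ ⊥ →
    ∃ J : Ideal R, IsGVIdeal J ∧
      (J : FractionalIdeal (nonZeroDivisors R) K) ≤
        (I : FractionalIdeal (nonZeroDivisors R) K) *
          (I : FractionalIdeal (nonZeroDivisors R) K)⁻¹

namespace LinearMap

variable {R : Type*} [CommRing R] {M N P : Type*} [AddCommGroup M] [AddCommGroup N]
  [AddCommGroup P] [Module R M] [Module R N] [Module R P]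

theorem exists_comp_eq_of_injective {f : M →ₗ[R] P} {g : N →ₗ[R] P}
    (hg : Function.Injective g) (hfg : ∀ m, f m ∈ range g) : ∃ l : M →ₗ[R] N, g ∘ₗ l = f := by
  refine ⟨(LinearEquiv.ofInjective g hg).symm ∘ₗ f.codRestrict (range g) hfg, ?_⟩
  ext m
  simp

theorem comp_mem_range_dualTensorHom {f : M →ₗ[R] N} (hf : f ∈ range (dualTensorHom R M N))
    (g : N →ₗ[R] P) : g ∘ₗ f ∈ range (dualTensorHom R M P) := by
  obtain ⟨t, rfl⟩ := hf
  refine ⟨g.lTensor _ t, ?_⟩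
  induction t with
  | zero => simp
  | tmul φ n => ext; simp [dualTensorHom_apply]
  | add s t hs ht => simp only [map_add, hs, ht, comp_add]

theorem mem_range_dualTensorHom_comp {f : N →ₗ[R] P} (hf : f ∈ range (dualTensorHom R N P))
    (g : M →ₗ[R] N) : f ∘ₗ g ∈ range (dualTensorHom R M P) := by
  obtain ⟨t, rfl⟩ := hf
  refine ⟨(Module.Dual.transpose (R := R) g).rTensor _ t, ?_⟩
  induction t with
  | zero => simp
  | tmul φ n => rfl
  | add s t hs ht => simp only [map_add, hs, ht, add_comp]

/-- A map factoring through a finite free module lifts along surjections. -/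
theorem exists_lift_of_mem_range_dualTensorHom {f : M →ₗ[R] N}
    (hf : f ∈ range (dualTensorHom R M N)) {π : P →ₗ[R] N} (hπ : Function.Surjective π) :
    ∃ h ∈ range (dualTensorHom R M P), π ∘ₗ h = f := by
  obtain ⟨t, rfl⟩ := hf
  obtain ⟨s, rfl⟩ := lTensor_surjective (Module.Dual R M) hπ t
  refine ⟨_, ⟨s, rfl⟩, ?_⟩
  induction s with
  | zero => simp
  | tmul φ n => ext; simp [dualTensorHom_apply]
  | add s t hs ht => simp only [map_add, hs, ht, comp_add]

end LinearMap

/-- The ideal of those `d` for which multiplication by `d` on `N` factors through a finite free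
module. -/
def finiteFreeFactorIdeal (R : Type*) [CommRing R] (N : Type*) [AddCommGroup N] [Module R N] :
    Ideal R :=
  (LinearMap.range (dualTensorHom R N N)).comap (LinearMap.toSpanSingleton R _ LinearMap.id)

theorem mem_finiteFreeFactorIdeal {R : Type*} [CommRing R] {N : Type*} [AddCommGroup N]
    [Module R N] {d : R} : d ∈ finiteFreeFactorIdeal R N ↔
      d • (LinearMap.id : N →ₗ[R] N) ∈ LinearMap.range (dualTensorHom R N N) :=
  Iff.rfl

/-- If `N` is an extension of `p.range` by `p.ker`, then the factorization ideals multiply. -/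
theorem mul_finiteFreeFactorIdeal_le {R : Type*} [CommRing R] {N P : Type*} [AddCommGroup N]
    [Module R N] [AddCommGroup P] [Module R P] (p : N →ₗ[R] P) :
    finiteFreeFactorIdeal R p.range * finiteFreeFactorIdeal R p.ker ≤
      finiteFreeFactorIdeal R N := by
  rw [Ideal.mul_le]
  intro d hd e he
  obtain ⟨h, hh, hph⟩ := LinearMap.exists_lift_of_mem_range_dualTensorHom
    (mem_finiteFreeFactorIdeal.1 hd) p.surjective_rangeRestrict
  have hker (n : N) : (d • LinearMap.id - h ∘ₗ p.rangeRestrict : N →ₗ[R] N) n ∈ p.ker := by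
    have := congrArg Subtype.val (LinearMap.congr_fun hph (p.rangeRestrict n))
    simp at this
    simp [this]
  let q := LinearMap.codRestrict p.ker _ hker
  have hsum : (d * e) • (LinearMap.id : N →ₗ[R] N) =
      p.ker.subtype ∘ₗ (e • LinearMap.id) ∘ₗ q + e • (h ∘ₗ p.rangeRestrict) := by
    ext n
    simp [q, smul_sub, mul_smul, smul_comm d e]
  rw [mem_finiteFreeFactorIdeal, hsum]
  exact add_mem (LinearMap.comp_mem_range_dualTensorHom
    (LinearMap.mem_range_dualTensorHom_comp he q) _)
    (Submodule.smul_mem _ _ (LinearMap.mem_range_dualTensorHom_comp hh _))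

theorem finiteFreeFactorIdeal_eq_top_of_subsingleton (R : Type*) [CommRing R] (N : Type*)
    [AddCommGroup N] [Module R N] [Subsingleton N] : finiteFreeFactorIdeal R N = ⊤ := by
  refine (Ideal.eq_top_iff_one _).2 ⟨0, ?_⟩
  ext n
  exact Subsingleton.elim _ _

theorem isGVIdeal_top (R : Type*) [CommRing R] : IsGVIdeal (⊤ : Ideal R) := by
  refine ⟨⟨{1}, by simp⟩, fun r s h => ?_, fun f => ⟨f ⟨1, trivial⟩, ?_⟩⟩
  · simpa using LinearMap.congr_fun h ⟨1, trivial⟩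
  · ext ⟨x, hx⟩
    have := f.map_smul x ⟨1, trivial⟩
    have hx1 : x • (⟨1, trivial⟩ : (⊤ : Ideal R)) = ⟨x, hx⟩ := Subtype.ext (mul_one x)
    rw [hx1, smul_eq_mul] at this
    simp [this, mul_comm]

theorem IsGVIdeal.mul {R : Type*} [CommRing R] {I J : Ideal R} (hI : IsGVIdeal I)
    (hJ : IsGVIdeal J) : IsGVIdeal (I * J) := by
  refine ⟨Submodule.FG.mul hI.1 hJ.1, fun r s h => ?_, fun f => ?_⟩
  · refine hI.2.1 (LinearMap.ext fun a => ?_)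
    have hJa : (r * a) • J.subtype = (s * a) • J.subtype := LinearMap.ext fun b => by
      simpa [mul_assoc] using LinearMap.congr_fun h ⟨a * b, Ideal.mul_mem_mul a.2 b.2⟩
    simpa using hJ.2.1 hJa
  · let eJ : R ≃ₗ[R] (J →ₗ[R] R) :=
      LinearEquiv.ofBijective (LinearMap.toSpanSingleton R _ J.subtype) hJ.2
    let F : I →ₗ[R] J →ₗ[R] R := LinearMap.mk₂ R
      (fun a b => f ⟨a * b, Ideal.mul_mem_mul a.2 b.2⟩)
      (fun a a' b => by rw [← map_add]; congr 1; ext; simp [add_mul])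
      (fun c a b => by rw [← map_smul]; congr 1; ext; simp [mul_assoc])
      (fun a b b' => by rw [← map_add]; congr 1; ext; simp [mul_add])
      (fun c a b => by rw [← map_smul]; congr 1; ext; simp [mul_left_comm])
    obtain ⟨r, hr⟩ := hI.2.2 (eJ.symm ∘ₗ F)
    have hF (a : I) (b : J) : f ⟨a * b, Ideal.mul_mem_mul a.2 b.2⟩ = r * (a * b) := by
      have h1 : r * a = eJ.symm (F a) := LinearMap.congr_fun hr a
      have h2 : F a = (r * a : R) • J.subtype := by
        rw [h1]; exact (eJ.apply_symm_apply (F a)).symm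
      simpa [F, mul_assoc] using LinearMap.congr_fun h2 b
    refine ⟨r, LinearMap.ext fun ⟨x, hx⟩ => ?_⟩
    induction hx using Submodule.mul_induction_on' with
    | mem_mul_mem a ha b hb => simpa using (hF ⟨a, ha⟩ ⟨b, hb⟩).symm
    | add x hx y hy h1 h2 =>
      have := f.map_add ⟨x, hx⟩ ⟨y, hy⟩
      simp only [AddMemClass.mk_add_mk] at this
      simp_all [mul_add]

section Krull

variable {R : Type*} [CommRing R] [IsDomain R]

open scoped nonZeroDivisors

theorem mem_finiteFreeFactorIdeal_of_mem_mul_inv {K : Type*} [Field K] [Algebra R K]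
    [IsFractionRing R K] {I : Ideal R} (hI : I ≠ ⊥) {d : R}
    (hd : algebraMap R K d ∈ (I : FractionalIdeal R⁰ K) * (I : FractionalIdeal R⁰ K)⁻¹) :
    d ∈ finiteFreeFactorIdeal R I := by
  have hinj := IsFractionRing.injective R K
  suffices h : ∀ z ∈ (I : FractionalIdeal R⁰ K) * (I : FractionalIdeal R⁰ K)⁻¹,
      ∃ t, ∀ y : I, algebraMap R K (dualTensorHom R I I t y) = z * algebraMap R K y by
    obtain ⟨t, ht⟩ := h _ hd
    refine ⟨t, LinearMap.ext fun y => Subtype.ext (hinj ?_)⟩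
    simp [ht]
  intro z hz
  refine FractionalIdeal.mul_induction_on hz (fun z hz x hx => ?_) fun x y hx hy => ?_
  · obtain ⟨i, hi, rfl⟩ := (FractionalIdeal.mem_coeIdeal _).1 hz
    rw [FractionalIdeal.mem_inv_iff (FractionalIdeal.coeIdeal_ne_zero.2 hI)] at hx
    obtain ⟨f, hf⟩ := LinearMap.exists_comp_eq_of_injective
      (f := x • (Algebra.linearMap R K ∘ₗ I.subtype)) (g := Algebra.linearMap R K) hinj
      fun y => by
        obtain ⟨r, hr⟩ := (FractionalIdeal.mem_one_iff _).1
          (hx _ (FractionalIdeal.mem_coeIdeal_of_mem _ y.2))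
        exact ⟨r, by simpa using hr⟩
    refine ⟨f ⊗ₜ ⟨i, hi⟩, fun y => ?_⟩
    have hy : algebraMap R K (f y) = x * algebraMap R K y := LinearMap.congr_fun hf y
    simp only [dualTensorHom_apply, SetLike.mk_smul_mk, smul_eq_mul, map_mul, hy]
    ring
  · obtain ⟨s, hs⟩ := hx
    obtain ⟨t, ht⟩ := hy
    exact ⟨s + t, fun y => by simp [hs, ht, add_mul]⟩

theorem IsKrullDomainW.exists_isGVIdeal_le_of_ideal {K : Type*} [Field K] [Algebra R K]
    [IsFractionRing R K] (hR : IsKrullDomainW R K) (I : Ideal R) :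
    ∃ J, IsGVIdeal J ∧ J ≤ finiteFreeFactorIdeal R I := by
  by_cases hI : I = ⊥
  · subst hI
    exact ⟨⊤, isGVIdeal_top R, (finiteFreeFactorIdeal_eq_top_of_subsingleton R _).ge⟩
  · obtain ⟨J, hJ, hle⟩ := hR I hI
    exact ⟨J, hJ, fun d hd => mem_finiteFreeFactorIdeal_of_mem_mul_inv hI
      (hle (FractionalIdeal.mem_coeIdeal_of_mem _ hd))⟩

theorem IsKrullDomainW.exists_isGVIdeal_le_of_injective {K : Type*} [Field K] [Algebra R K]
    [IsFractionRing R K] (hR : IsKrullDomainW R K) {n : ℕ} {N : Type*} [AddCommGroup N]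
    [Module R N] (f : N →ₗ[R] (Fin n → R)) (hf : Function.Injective f) :
    ∃ J, IsGVIdeal J ∧ J ≤ finiteFreeFactorIdeal R N := by
  induction n generalizing N with
  | zero =>
    have := hf.subsingleton
    exact ⟨⊤, isGVIdeal_top R, (finiteFreeFactorIdeal_eq_top_of_subsingleton R _).ge⟩
  | succ n ih =>
    let p : N →ₗ[R] R := LinearMap.proj 0 ∘ₗ f
    obtain ⟨J₁, hJ₁, h₁⟩ := hR.exists_isGVIdeal_le_of_ideal p.range
    obtain ⟨J₂, hJ₂, h₂⟩ := ih (LinearMap.funLeft R R Fin.succ ∘ₗ f ∘ₗ p.ker.subtype)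
      fun x y hxy => Subtype.ext <| hf <| funext <| Fin.cases
        ((LinearMap.mem_ker.1 x.2).trans (LinearMap.mem_ker.1 y.2).symm) (congrFun hxy)
    exact ⟨J₁ * J₂, hJ₁.mul hJ₂, (Ideal.mul_mono h₁ h₂).trans (mul_finiteFreeFactorIdeal_le p)⟩

/-- A finitely generated torsion-free module over a domain embeds in a finite free module. -/
theorem Module.exists_injective_fin_of_isTorsionFree (N : Type*) [AddCommGroup N]
    [Module R N] [Module.Finite R N] [Module.IsTorsionFree R N] :
    ∃ (n : ℕ) (f : N →ₗ[R] (Fin n → R)), Function.Injective f := by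
  let K := FractionRing R
  let ι := TensorProduct.mk R K N 1
  have hι : Function.Injective ι := (IsLocalizedModule.injective_iff_isRegular R⁰ ι).2 fun c =>
    (isRegular_iff_ne_zero.2 (nonZeroDivisors.coe_ne_zero c)).isSMulRegular
  let b := Module.finBasis K (K ⊗[R] N)
  let g : N →ₗ[R] (Fin _ → K) := b.equivFun.toLinearMap.restrictScalars R ∘ₗ ι
  have hg : Function.Injective g := b.equivFun.injective.comp hι
  obtain ⟨s, hs⟩ := Module.Finite.fg_top (R := R) (M := N)
  obtain ⟨c, hc⟩ := IsLocalization.exist_integer_multiples_of_finite R⁰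
    (fun x : s × Fin _ => g x.1 x.2)
  let j := (Algebra.linearMap R K).compLeft (Fin (Module.finrank K (K ⊗[R] N)))
  have hj : Function.Injective j := fun x y hxy =>
    funext fun i => IsFractionRing.injective R K (congrFun hxy i)
  obtain ⟨f, hf⟩ := LinearMap.exists_comp_eq_of_injective (f := (c : R) • g) hj fun x => by
    have hle : Submodule.span R (s : Set N) ≤ (LinearMap.range j).comap ((c : R) • g) :=
      Submodule.span_le.2 fun y hy => by
        choose r hr using fun i => hc (⟨y, hy⟩, i)
        exact ⟨r, funext hr⟩
    exact hle (hs ▸ trivial)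
  refine ⟨_, f, fun x y hxy => hg ?_⟩
  have h := congrArg j hxy
  change (j ∘ₗ f) x = (j ∘ₗ f) y at h
  rw [hf] at h
  exact smul_right_injective _ (nonZeroDivisors.coe_ne_zero c) h

theorem IsKrullDomainW.exists_isGVIdeal_forall_exists_comp_mkQ_eq_smul {K : Type*} [Field K]
    [Algebra R K] [IsFractionRing R K] (hR : IsKrullDomainW R K) (M : Type*) [AddCommGroup M]
    [Module R M] [Module.Finite R M] :
    ∃ J : Ideal R, IsGVIdeal J ∧ ∀ d ∈ J, ∃ h : (M ⧸ Submodule.torsion R M) →ₗ[R] M,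
      (Submodule.torsion R M).mkQ ∘ₗ h = d • LinearMap.id := by
  obtain ⟨n, f, hf⟩ :=
    Module.exists_injective_fin_of_isTorsionFree (R := R) (M ⧸ Submodule.torsion R M)
  obtain ⟨J, hJ, hle⟩ := hR.exists_isGVIdeal_le_of_injective f hf
  refine ⟨J, hJ, fun d hd => ?_⟩
  obtain ⟨h, -, hh⟩ := LinearMap.exists_lift_of_mem_range_dualTensorHom
    (mem_finiteFreeFactorIdeal.1 (hle hd)) (Submodule.mkQ_surjective _)
  exact ⟨h, hh⟩

/-- Over a Krull domain, the torsion submodule is a `w`-pure submodule. -/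
theorem IsKrullDomainW.isGVTorsionElem_of_lTensor_torsion_eq_zero {K : Type*} [Field K]
    [Algebra R K] [IsFractionRing R K] (hR : IsKrullDomainW R K) {M L : Type*}
    [AddCommGroup M] [Module R M] [AddCommGroup L] [Module R L]
    {x : L ⊗[R] Submodule.torsion R M}
    (hx : (Submodule.torsion R M).subtype.lTensor L x = 0) : IsGVTorsionElem R x := by
  obtain ⟨P, hP, hPT, y, hy⟩ :=
    Submodule.exists_fg_le_eq_rTensor_inclusion (TensorProduct.comm R _ _ x)
  have hy0 : P.subtype.rTensor L y = 0 := by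
    have : P.subtype = (Submodule.torsion R M).subtype ∘ₗ P.inclusion hPT := rfl
    rw [this, LinearMap.rTensor_comp_apply, ← hy, LinearMap.rTensor_comm, hx, map_zero]
  obtain ⟨Q, hPQ, hQ, hyQ⟩ := TensorProduct.eq_zero_of_fg_of_subtype_eq_zero hP hy0
  have : Module.Finite R Q := Module.Finite.iff_fg.2 hQ
  obtain ⟨J, hJ, hsplit⟩ := hR.exists_isGVIdeal_forall_exists_comp_mkQ_eq_smul Q
  refine ⟨J, hJ, fun d hd => ?_⟩
  obtain ⟨h, hh⟩ := hsplit d hd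
  let π := (Submodule.torsion R Q).mkQ
  have hmem (q : Q) : (Q.subtype ∘ₗ (d • LinearMap.id - h ∘ₗ π)) q ∈ Submodule.torsion R M := by
    have : (d • LinearMap.id - h ∘ₗ π : Q →ₗ[R] Q) q ∈ Submodule.torsion R Q := by
      refine (Submodule.Quotient.mk_eq_zero _).1 ?_
      change π _ = 0
      have : π (h (π q)) = d • π q := LinearMap.congr_fun hh (π q)
      simp [this]
    obtain ⟨a, ha⟩ := this
    exact ⟨a, congrArg Subtype.val ha⟩
  let r := LinearMap.codRestrict (Submodule.torsion R M) _ hmem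
  have hr : r ∘ₗ P.inclusion hPQ = d • P.inclusion hPT := by
    ext p
    have hp : π (P.inclusion hPQ p) = 0 := by
      rw [← LinearMap.mem_ker, Submodule.ker_mkQ]
      obtain ⟨a, ha⟩ := hPT p.2
      exact ⟨a, Subtype.ext ha⟩
    simp [r, hp]
  apply (TensorProduct.comm R _ _).injective
  rw [map_smul, hy, map_zero, ← LinearMap.smul_apply, ← LinearMap.rTensor_smul, ← hr,
    LinearMap.rTensor_comp_apply, hyQ, map_zero]

end Krull

/-- over a Krull domain, (a) the torsion submodule of any module is
`w`-pure, and (b) for every finitely generated module the canonical short exact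
sequence `0 → T(M) → M → M/T(M) → 0` w-splits. -/
theorem krull_torsion_wpure_and_wsplit
    {R : Type u} [CommRing R] [IsDomain R]
    (hKrull : IsKrullDomainW R (FractionRing R)) :
    (∀ (M : Type u) [AddCommGroup M] [Module R M]
      (L : Type u) [AddCommGroup L] [Module R L],
      ∀ x ∈ LinearMap.ker (LinearMap.lTensor L (Submodule.torsion R M).subtype),
        IsGVTorsionElem R x) ∧
    (∀ (M : Type u) [AddCommGroup M] [Module R M] [Module.Finite R M],
      ∃ J : Ideal R, IsGVIdeal J ∧
        ∀ d ∈ J, ∃ h : (M ⧸ Submodule.torsion R M) →ₗ[R] M,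
          (Submodule.torsion R M).mkQ ∘ₗ h = d • LinearMap.id) := by
  exact ⟨fun M _ _ L _ _ x hx => hKrull.isGVTorsionElem_of_lTensor_torsion_eq_zero hx,
    fun M _ _ _ => hKrull.exists_isGVIdeal_forall_exists_comp_mkQ_eq_smul M⟩
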